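/- For every d, n, s, N, L ∈ ℕ₊ there exists a Transformer network TF₁ of width d' at most 12·s·d^s·N and depth at most (s−1)(L+1)+1, whose unique non-identity attention layer has a single head, such that for every X ∈ [0,1]^{d×n}, feeding TF₁ the matrix in ℝ^{d'×(n+1)} whose top-left d×n block is X and whose remaining entries are 0, the (n+1)-th column of the output contains, in designated coordinates indexed by the exponent vectors p ∈ ℕ^d with 1 ≤ |p| ≤ s, the values m_p(X) + E_p(X), where m_p is the rank-1 monomial column-symmetric polynomial and the errors satisfy |E_p(X)| ≤ n·(|p|−1)·N^{−L}. -/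

import Mathlib

open scoped Matrix

/-- Entrywise ReLU. -/
def relu (x : ℝ) : ℝ := max 0 x

/-- Entrywise ReLU on matrices. -/
def reluM {a b : ℕ} (X : Matrix (Fin a) (Fin b) ℝ) : Matrix (Fin a) (Fin b) ℝ :=
  Matrix.of fun i j => relu (X i j)

/-- Column-wise softmax: entry `(i,j)` is `exp(−A_{ij}) / Σ_l exp(−A_{lj})`. -/
noncomputable def softmax {n : ℕ} (A : Matrix (Fin n) (Fin n) ℝ) :
    Matrix (Fin n) (Fin n) ℝ :=
  Matrix.of fun i j => Real.exp (-(A i j)) / ∑ l, Real.exp (-(A l j))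

/-- The parameters of an attention layer on `ℝ^{d×·}` with `h` heads and inner
dimension `m`. -/
structure AttnLayer (d : ℕ) where
  m : ℕ
  h : ℕ
  WO : Fin h → Matrix (Fin d) (Fin m) ℝ
  WV : Fin h → Matrix (Fin m) (Fin d) ℝ
  WK : Fin h → Matrix (Fin m) (Fin d) ℝ
  WQ : Fin h → Matrix (Fin m) (Fin d) ℝ

/-- `Attn(X) = X + Σ_i WO^i WV^i X · softmax((WK^i X)^⊤ WQ^i X)`. -/
noncomputable def AttnLayer.apply {d : ℕ} (A : AttnLayer d) {n : ℕ}
    (X : Matrix (Fin d) (Fin n) ℝ) : Matrix (Fin d) (Fin n) ℝ :=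
  X + ∑ i, A.WO i * (A.WV i * X * softmax ((A.WK i * X)ᵀ * (A.WQ i * X)))

/-- The parameters of a feed-forward layer on `ℝ^{d×·}` with inner dimension `r`. -/
structure FFLayer (d : ℕ) where
  r : ℕ
  W1 : Matrix (Fin r) (Fin d) ℝ
  W2 : Matrix (Fin d) (Fin r) ℝ
  b1 : Fin r → ℝ
  b2 : Fin d → ℝ

/-- `FF(X) = X + W₂ · ReLU(W₁ X + b₁ 1ₙ^⊤) + b₂ 1ₙ^⊤`. -/
def FFLayer.apply {d : ℕ} (F : FFLayer d) {n : ℕ}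
    (X : Matrix (Fin d) (Fin n) ℝ) : Matrix (Fin d) (Fin n) ℝ :=
  X + F.W2 * reluM (F.W1 * X + Matrix.of fun i _ => F.b1 i) +
    Matrix.of fun i _ => F.b2 i

/-- A Transformer block `TB = FF ∘ Attn`. -/
structure TransformerBlock (d : ℕ) where
  attn : AttnLayer d
  ff : FFLayer d

/-- Applying a Transformer block: `TB(X) = FF(Attn(X))`. -/
noncomputable def TransformerBlock.apply {d : ℕ} (B : TransformerBlock d) {n : ℕ}
    (X : Matrix (Fin d) (Fin n) ℝ) : Matrix (Fin d) (Fin n) ℝ :=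
  B.ff.apply (B.attn.apply X)

/-- Applying a Transformer network (a composition of Transformer blocks). -/
noncomputable def applyNet {d : ℕ} (net : List (TransformerBlock d)) {n : ℕ}
    (X : Matrix (Fin d) (Fin n) ℝ) : Matrix (Fin d) (Fin n) ℝ :=
  net.foldl (fun Y B => B.apply Y) X

/-- Embed a `d × n` matrix into the top-left block of a `d' × n'` matrix,
filling the remaining entries with zeros. -/
def embed {d n : ℕ} (d' n' : ℕ) (X : Matrix (Fin d) (Fin n) ℝ) :
    Matrix (Fin d') (Fin n') ℝ :=
  Matrix.of fun i j =>
    if h : (i : ℕ) < d ∧ (j : ℕ) < n then X ⟨i, h.1⟩ ⟨j, h.2⟩ else 0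

/-- The rank-`r` monomial column-symmetric polynomial
`m_{p_1,…,p_r}(X) = Σ_{σ ∈ S_n} (1/(n−r)!) x_{σ(1)}^{p_1} ⋯ x_{σ(r)}^{p_r}`
(as a function), with the convention that it is `0` if `r > n`. -/
noncomputable def msym {d n r : ℕ} (p : Fin r → Fin d → ℕ)
    (X : Matrix (Fin d) (Fin n) ℝ) : ℝ :=
  if h : r ≤ n then
    (((n - r).factorial : ℕ) : ℝ)⁻¹ *
      ∑ σ : Equiv.Perm (Fin n), ∏ j : Fin r, ∏ i : Fin d,
        X i (σ (Fin.castLE h j)) ^ p j i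
  else 0

/-! ### Piecewise linear approximation of `x - x²` -/

section Tent

/-- The ReLU coefficients of the continuous sawtooth with `N` linear pieces on `[0,1]`. -/
noncomputable def sawCoeff (N j : ℕ) : ℝ := if j = 0 then N else 2 * N * (-1) ^ j

/-- The ReLU coefficients of the interpolant of `x - x²` at the nodes `k / N`. -/
noncomputable def bumpCoeff (N j : ℕ) : ℝ := if j = 0 then 1 - 1 / N else -(2 / N)

/-- The continuous sawtooth with `N` linear pieces on `[0,1]`. -/
noncomputable def saw (N : ℕ) (x : ℝ) : ℝ := ∑ j : Fin N, sawCoeff N j * relu (x - j / N)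

/-- The piecewise linear interpolant of `x - x²` at the nodes `k / N`. -/
noncomputable def bump (N : ℕ) (x : ℝ) : ℝ := ∑ j : Fin N, bumpCoeff N j * relu (x - j / N)

/-- The `t`-step approximation of `x - x²`. -/
noncomputable def bumpSum (N t : ℕ) (x : ℝ) : ℝ :=
  ∑ i ∈ Finset.range t, ((N : ℝ) ^ (2 * i))⁻¹ * bump N ((saw N)^[i] x)

lemma sum_relu_eq_of_mem {N k : ℕ} (hk : k < N) (c : ℕ → ℝ) {x : ℝ}
    (h1 : (k : ℝ) / N ≤ x) (h2 : x ≤ (k + 1) / N) :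
    ∑ j : Fin N, c j * relu (x - j / N) = ∑ j ∈ Finset.range (k + 1), c j * (x - j / N) := by
  rw [Fin.sum_univ_eq_sum_range (fun j => c j * relu (x - j / N)) N]
  rw [← Finset.sum_subset (Finset.range_subset_range.2 (Nat.succ_le_of_lt hk))]
  · refine Finset.sum_congr rfl fun j hj => ?_
    have hj' : (j : ℝ) ≤ k := by
      exact_mod_cast Nat.lt_succ_iff.1 (Finset.mem_range.1 hj)
    have : (j : ℝ) / N ≤ k / N := by gcongr
    rw [relu, max_eq_right (by linarith)]
  · intro j _ hj
    have hj' : (k : ℝ) + 1 ≤ j := by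
      have : k + 1 ≤ j := by simpa using hj
      exact_mod_cast this
    have : ((k : ℝ) + 1) / N ≤ j / N := by gcongr
    rw [relu, max_eq_left (by linarith), mul_zero]

lemma sum_sawCoeff {N : ℕ} (hN : 0 < N) (k : ℕ) (x : ℝ) :
    ∑ j ∈ Finset.range (k + 1), sawCoeff N j * (x - j / N) =
      1 / 2 + (-1) ^ k * (N * x - k - 1 / 2) := by
  have hN' : (N : ℝ) ≠ 0 := by positivity
  induction k with
  | zero => simp [sawCoeff]
  | succ k ih =>
    rw [Finset.sum_range_succ, ih, sawCoeff, if_neg (Nat.succ_ne_zero k), pow_succ]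
    push_cast
    field_simp
    ring

lemma sum_bumpCoeff {N : ℕ} (hN : 0 < N) (k : ℕ) (x : ℝ) :
    ∑ j ∈ Finset.range (k + 1), bumpCoeff N j * (x - j / N) =
      x * (1 - (2 * k + 1) / N) + k * (k + 1) / N ^ 2 := by
  have hN' : (N : ℝ) ≠ 0 := by positivity
  induction k with
  | zero => simp [bumpCoeff]; ring
  | succ k ih =>
    rw [Finset.sum_range_succ, ih, bumpCoeff, if_neg (Nat.succ_ne_zero k)]
    push_cast
    field_simp
    ring

lemma exists_piece {N : ℕ} (hN : 0 < N) {x : ℝ} (hx : x ∈ Set.Icc (0 : ℝ) 1) :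
    ∃ k < N, (k : ℝ) / N ≤ x ∧ x ≤ (k + 1) / N := by
  have hN' : (0 : ℝ) < N := by positivity
  have hNx : 0 ≤ (N : ℝ) * x := mul_nonneg hN'.le hx.1
  rcases eq_or_lt_of_le hx.2 with rfl | hlt
  · have h : ((N - 1 : ℕ) : ℝ) = N - 1 := by
      rw [Nat.cast_sub hN, Nat.cast_one]
    refine ⟨N - 1, by omega, ?_, ?_⟩ <;> rw [h]
    · rw [div_le_one hN']; linarith
    · rw [le_div_iff₀ hN']; linarith
  · refine ⟨⌊(N : ℝ) * x⌋₊, ?_, ?_, ?_⟩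
    · rw [Nat.floor_lt hNx]; nlinarith
    · rw [div_le_iff₀ hN']; linarith [Nat.floor_le hNx]
    · rw [le_div_iff₀ hN']; linarith [Nat.lt_floor_add_one ((N : ℝ) * x)]

lemma saw_mem_and_bump_add {N : ℕ} (hN : 0 < N) {x : ℝ} (hx : x ∈ Set.Icc (0 : ℝ) 1) :
    saw N x ∈ Set.Icc (0 : ℝ) 1 ∧
      bump N x + ((N : ℝ) ^ 2)⁻¹ * (saw N x - saw N x ^ 2) = x - x ^ 2 := by
  obtain ⟨k, hk, h1, h2⟩ := exists_piece hN hx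
  have hN' : (0 : ℝ) < N := by positivity
  rw [saw, bump, sum_relu_eq_of_mem hk (sawCoeff N) h1 h2,
    sum_relu_eq_of_mem hk (bumpCoeff N) h1 h2, sum_sawCoeff hN, sum_bumpCoeff hN]
  rw [div_le_iff₀ hN'] at h1
  rw [le_div_iff₀ hN'] at h2
  rcases neg_one_pow_eq_or ℝ k with h | h <;> rw [h]
  · refine ⟨⟨by linarith, by linarith⟩, ?_⟩
    field_simp
    ring
  · refine ⟨⟨by linarith, by linarith⟩, ?_⟩
    field_simp
    ring

lemma saw_iterate_mem {N : ℕ} (hN : 0 < N) {x : ℝ} (hx : x ∈ Set.Icc (0 : ℝ) 1) (t : ℕ) :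
    (saw N)^[t] x ∈ Set.Icc (0 : ℝ) 1 := by
  induction t with
  | zero => exact hx
  | succ t ih =>
    rw [Function.iterate_succ_apply']
    exact (saw_mem_and_bump_add hN ih).1

lemma bumpSum_add {N : ℕ} (hN : 0 < N) {x : ℝ} (hx : x ∈ Set.Icc (0 : ℝ) 1) (t : ℕ) :
    bumpSum N t x + ((N : ℝ) ^ (2 * t))⁻¹ * ((saw N)^[t] x - (saw N)^[t] x ^ 2) = x - x ^ 2 := by
  induction t with
  | zero => simp [bumpSum]
  | succ t ih =>
    have h := (saw_mem_and_bump_add hN (saw_iterate_mem hN hx t)).2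
    rw [← ih, bumpSum, bumpSum, Finset.sum_range_succ, ← h, Function.iterate_succ_apply',
      mul_add 2 t 1, pow_add, mul_inv]
    ring

/-- The approximate product computed from `t`-step approximations of squares. -/
noncomputable def approxMul (N t : ℕ) (x y : ℝ) : ℝ :=
  (x + y) / 2 - 1 / 4 - bumpSum N t ((x + y) / 2) + bumpSum N t ((x - y) / 2 + 1 / 2)

lemma abs_approxMul_sub_le {N : ℕ} (hN : 0 < N) (t : ℕ) {x y : ℝ}
    (hx : x ∈ Set.Icc (0 : ℝ) 1) (hy : y ∈ Set.Icc (0 : ℝ) 1) :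
    |approxMul N t x y - x * y| ≤ 1 / (N : ℝ) ^ t := by
  obtain ⟨hx0, hx1⟩ := hx
  obtain ⟨hy0, hy1⟩ := hy
  have ha : (x + y) / 2 ∈ Set.Icc (0 : ℝ) 1 := ⟨by linarith, by linarith⟩
  have hb : (x - y) / 2 + 1 / 2 ∈ Set.Icc (0 : ℝ) 1 := ⟨by linarith, by linarith⟩
  have h1 := bumpSum_add hN ha t
  have h2 := bumpSum_add hN hb t
  obtain ⟨ha0, ha1⟩ := saw_iterate_mem hN ha t
  obtain ⟨hb0, hb1⟩ := saw_iterate_mem hN hb t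
  rw [approxMul]
  set u := (saw N)^[t] ((x + y) / 2)
  set v := (saw N)^[t] ((x - y) / 2 + 1 / 2)
  have hN1 : (1 : ℝ) ≤ (N : ℝ) ^ t := one_le_pow₀ (by exact_mod_cast hN)
  have hle : ((N : ℝ) ^ (2 * t))⁻¹ ≤ 1 / (N : ℝ) ^ t := by
    rw [one_div]
    exact inv_anti₀ (by positivity) (by rw [two_mul, pow_add]; nlinarith)
  have hpos : 0 ≤ ((N : ℝ) ^ (2 * t))⁻¹ := by positivity
  have key : (x + y) / 2 - 1 / 4 - bumpSum N t ((x + y) / 2)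
      + bumpSum N t ((x - y) / 2 + 1 / 2) - x * y =
      ((N : ℝ) ^ (2 * t))⁻¹ * ((u - u ^ 2) - (v - v ^ 2)) := by
    linear_combination -h1 + h2
  rw [key, abs_mul, abs_of_nonneg hpos]
  have : |(u - u ^ 2) - (v - v ^ 2)| ≤ 1 := by
    rw [abs_le]; constructor <;> nlinarith
  calc _ ≤ ((N : ℝ) ^ (2 * t))⁻¹ * 1 := by gcongr
    _ ≤ _ := by simpa using hle

lemma relu_sub_relu_mem (a : ℝ) : relu a - relu (a - 1) ∈ Set.Icc (0 : ℝ) 1 := by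
  unfold relu
  constructor <;> rcases max_cases 0 a with h | h <;> rcases max_cases 0 (a - 1) with h' | h' <;>
    linarith

lemma abs_relu_sub_relu_sub_le {a b : ℝ} (hb : b ∈ Set.Icc (0 : ℝ) 1) :
    |relu a - relu (a - 1) - b| ≤ |a - b| := by
  obtain ⟨h0, h1⟩ := hb
  unfold relu
  rcases max_cases 0 a with h | h <;> rcases max_cases 0 (a - 1) with h' | h' <;>
    rcases abs_cases (a - b) with h'' | h'' <;> rw [abs_le] <;> constructor <;> linarith

end Tent

/-! ### Networks acting columnwise -/

lemma applyNet_append {d' k : ℕ} (net₁ net₂ : List (TransformerBlock d'))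
    (X : Matrix (Fin d') (Fin k) ℝ) :
    applyNet (net₁ ++ net₂) X = applyNet net₂ (applyNet net₁ X) :=
  List.foldl_append

/-- Some network of `len` blocks of inner widths at most `R`, all of whose attention layers are
the identity, acts on each column as `F`, with coordinates labelled through `e`. -/
def Realizes {ι : Type} {d' : ℕ} (e : ι ≃ Fin d') (R len : ℕ) (F : (ι → ℝ) → ι → ℝ) : Prop :=
  ∃ net : List (TransformerBlock d'), net.length = len ∧
    (∀ B ∈ net, (B.attn.m ≤ R ∧ B.ff.r ≤ R) ∧
      ∀ (k : ℕ) (Y : Matrix (Fin d') (Fin k) ℝ), B.attn.apply Y = Y) ∧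
    ∀ (k : ℕ) (X : Matrix (Fin d') (Fin k) ℝ) (i : ι) (j : Fin k),
      applyNet net X (e i) j = F (fun l => X (e l) j) i

namespace Realizes

variable {ι : Type} {d' : ℕ} {e : ι ≃ Fin d'} {R : ℕ}

lemma zero : Realizes e R 0 id :=
  ⟨[], rfl, by simp, fun _ _ _ _ => rfl⟩

lemma comp {a b : ℕ} {F G : (ι → ℝ) → ι → ℝ} (hG : Realizes e R b G) (hF : Realizes e R a F) :
    Realizes e R (a + b) (G ∘ F) := by
  obtain ⟨net₁, hl₁, hr₁, h₁⟩ := hF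
  obtain ⟨net₂, hl₂, hr₂, h₂⟩ := hG
  refine ⟨net₁ ++ net₂, by simp [hl₁, hl₂], ?_, fun k X i j => ?_⟩
  · intro B hB
    rcases List.mem_append.1 hB with h | h
    exacts [hr₁ B h, hr₂ B h]
  · rw [applyNet_append, h₂]
    simp only [h₁, Function.comp_apply]

lemma of_layer [Fintype ι] {κ : Type} [Fintype κ] (hκ : Fintype.card κ ≤ R)
    (ℓ : κ → (ι → ℝ) →ₗ[ℝ] ℝ) (b : κ → ℝ) (C : ι → κ → ℝ) (c : ι → ℝ) :
    Realizes e R 1 (fun z i => z i + ∑ q, C i q * relu (ℓ q z + b q) + c i) := by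
  classical
  let f := Fintype.equivFin κ
  refine ⟨[{ attn := ⟨0, 0, nofun, nofun, nofun, nofun⟩
             ff := ⟨Fintype.card κ,
                Matrix.of fun q l => ℓ (f.symm q) (Pi.single (e.symm l) 1),
                Matrix.of fun i q => C (e.symm i) (f.symm q),
                fun q => b (f.symm q), fun i => c (e.symm i)⟩ }], rfl, ?_, ?_⟩
  · simp [hκ, AttnLayer.apply]
  · intro k X i j
    have hℓ : ∀ q : κ, ∑ l, ℓ q (Pi.single (e.symm l) 1) * X l j = ℓ q (fun l => X (e l) j) := by
      intro q
      rw [LinearMap.pi_apply_eq_sum_univ (ℓ q) (fun l => X (e l) j), ← e.sum_comp]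
      refine Finset.sum_congr rfl fun l _ => ?_
      have : (Pi.single l 1 : ι → ℝ) = fun j => if l = j then 1 else 0 := by
        ext j; simp [Pi.single_apply, eq_comm]
      simp [this, mul_comm]
    simp only [applyNet, List.foldl_cons, List.foldl_nil, TransformerBlock.apply, AttnLayer.apply,
      Finset.univ_eq_empty, Finset.sum_empty, add_zero, FFLayer.apply, Matrix.add_apply,
      Matrix.mul_apply, Matrix.of_apply, Matrix.zero_apply, reluM, Equiv.symm_apply_apply, hℓ]
    rw [← f.symm.sum_comp]

end Realizes

/-! ### Multiplying a new variable onto every word -/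

section Words

variable {d S N : ℕ}

/-- Coordinates of the network: the input, and for every word and every multiplication four
registers: the product, the accumulator, and the two sawtooth iterates. -/
abbrev Coord (d S : ℕ) : Type := Fin d ⊕ (Fin 4 × Fin S × (Fin (S + 1) → Fin d))

/-- The coordinate holding the product of the first `k + 1` letters of `w`. -/
def wordCoord (w : Fin (S + 1) → Fin d) (k : Fin (S + 1)) : Coord d S :=
  Fin.cases (Sum.inl (w 0)) (fun k => Sum.inr (0, k, w)) k

/-- A layer updating the registers of multiplication `k` from two affine readings per word. -/
noncomputable def regUpdate (N : ℕ) (k : Fin S)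
    (ℓ : (Fin (S + 1) → Fin d) → Fin 2 → (Coord d S → ℝ) →ₗ[ℝ] ℝ) (b : Fin 2 → ℝ)
    (C : Fin 4 → Fin 2 → Fin N → ℝ) (c : Fin 4 → ℝ) (z : Coord d S → ℝ) : Coord d S → ℝ
  | Sum.inl i => z (Sum.inl i)
  | Sum.inr (q, k', w) => if k' = k then
      z (Sum.inr (q, k', w)) + ∑ p, ∑ j : Fin N, C q p j * relu (ℓ w p z + b p - j / N) + c q
      else z (Sum.inr (q, k', w))

lemma realizes_regUpdate {d' R : ℕ} (e : Coord d S ≃ Fin d') (hR : 2 * N * d ^ (S + 1) ≤ R)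
    (k : Fin S) (ℓ : (Fin (S + 1) → Fin d) → Fin 2 → (Coord d S → ℝ) →ₗ[ℝ] ℝ) (b : Fin 2 → ℝ)
    (C : Fin 4 → Fin 2 → Fin N → ℝ) (c : Fin 4 → ℝ) :
    Realizes e R 1 (regUpdate N k ℓ b C c) := by
  have hcard : Fintype.card ((Fin (S + 1) → Fin d) × Fin 2 × Fin N) ≤ R := by
    refine le_trans (le_of_eq ?_) hR
    simp; ring
  convert Realizes.of_layer (e := e) hcard (fun q => ℓ q.1 q.2.1)
    (fun q => b q.2.1 - q.2.2 / N)
    (fun i q => match i with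
      | Sum.inl _ => 0
      | Sum.inr (r, k', w) => if k' = k then (if q.1 = w then C r q.2.1 q.2.2 else 0) else 0)
    (fun i => match i with
      | Sum.inl _ => 0
      | Sum.inr (r, k', _) => if k' = k then c r else 0) using 1
  funext z i
  rcases i with i | ⟨r, k', w⟩
  · simp [regUpdate]
  · by_cases hk : k' = k
    · simp only [regUpdate, hk, if_true, Fintype.sum_prod_type, ite_mul, zero_mul]
      rw [Finset.sum_eq_single w (by intro w' _ h; simp [h]) (by simp)]
      simp [add_sub_assoc]
    · simp [regUpdate, hk]

lemma sum_coeff_sub_ite (hN : 0 < N) (c : ℕ → ℝ) (r : ℝ) {x : ℝ} (hx : 0 ≤ x) :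
    ∑ j : Fin N, (c j + if (j : ℕ) = 0 then r else 0) * relu (x - j / N) =
      ∑ j : Fin N, c j * relu (x - j / N) + r * x := by
  simp only [add_mul, Finset.sum_add_distrib]
  congr 1
  rw [Finset.sum_eq_single ⟨0, hN⟩]
  · simp [relu, hx]
  · intro j _ hj
    have : (j : ℕ) ≠ 0 := fun h => hj (Fin.ext h)
    simp [this]
  · simp

/-- The state after `t ≥ 1` sawtooth layers of multiplication `k`. -/
def AfterSteps (N : ℕ) (k : Fin S) (t : ℕ) (z z' : Coord d S → ℝ) : Prop :=
  (∀ i, z' (Sum.inl i) = z (Sum.inl i)) ∧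
  (∀ q k' w, k' ≠ k → z' (Sum.inr (q, k', w)) = z (Sum.inr (q, k', w))) ∧
  ∀ w, z' (Sum.inr (0, k, w)) = 0 ∧
    z' (Sum.inr (1, k, w)) =
      approxMul N t (z (Sum.inl (w k.succ))) (z (wordCoord w k.castSucc)) ∧
    z' (Sum.inr (2, k, w)) =
      (saw N)^[t] ((z (Sum.inl (w k.succ)) + z (wordCoord w k.castSucc)) / 2) ∧
    z' (Sum.inr (3, k, w)) =
      (saw N)^[t] ((z (Sum.inl (w k.succ)) - z (wordCoord w k.castSucc)) / 2 + 1 / 2)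

/-- The factors of multiplication `k` lie in `[0,1]` and its registers are empty. -/
def Ready (k : Fin S) (z : Coord d S → ℝ) : Prop :=
  (∀ q w, z (Sum.inr (q, k, w)) = 0) ∧
  (∀ i, z (Sum.inl i) ∈ Set.Icc (0 : ℝ) 1) ∧ ∀ w, z (wordCoord w k.castSucc) ∈ Set.Icc (0 : ℝ) 1

lemma exists_first_step {d' R : ℕ} (e : Coord d S ≃ Fin d') (hN : 0 < N)
    (hR : 2 * N * d ^ (S + 1) ≤ R) (k : Fin S) :
    ∃ F, Realizes e R 1 F ∧ ∀ z, Ready k z → AfterSteps N k 1 z (F z) := by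
  refine ⟨_, realizes_regUpdate e hR k
    (fun w =>
      let x : (Coord d S → ℝ) →ₗ[ℝ] ℝ := LinearMap.proj (Sum.inl (w k.succ))
      let y : (Coord d S → ℝ) →ₗ[ℝ] ℝ := LinearMap.proj (wordCoord w k.castSucc)
      ![(1 / 2 : ℝ) • (x + y), (1 / 2 : ℝ) • (x - y)])
    ![0, 1 / 2]
    ![![fun _ => 0, fun _ => 0],
      ![fun j => -bumpCoeff N j + if (j : ℕ) = 0 then 1 else 0, fun j => bumpCoeff N j],
      ![fun j => sawCoeff N j, fun _ => 0],
      ![fun _ => 0, fun j => sawCoeff N j]]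
    ![0, -(1 / 4), 0, 0], ?_⟩
  rintro z ⟨h0, hx, hy⟩
  refine ⟨fun i => rfl, fun q k' w hk => by simp [regUpdate, hk], fun w => ?_⟩
  have hx := hx (w k.succ)
  have hy := hy w
  set x := z (Sum.inl (w k.succ)) with hxd
  set y := z (wordCoord w k.castSucc) with hyd
  have ha : 0 ≤ (x + y) / 2 := by linarith [hx.1, hy.1]
  have e1 : (2 : ℝ)⁻¹ * x + 2⁻¹ * y = (x + y) / 2 := by ring
  have e2 : (2 : ℝ)⁻¹ * (x - y) = (x - y) / 2 := by ring
  have key := sum_coeff_sub_ite hN (fun j => -bumpCoeff N j) 1 ha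
  simp only [neg_mul, Finset.sum_neg_distrib, one_mul] at key
  refine ⟨by simp [regUpdate, h0], ?_, ?_, ?_⟩
  · simp [regUpdate, h0, ← hxd, ← hyd, e1, e2, key, approxMul, bumpSum, bump]
    ring
  · simp [regUpdate, h0, ← hxd, ← hyd, e1, saw]
  · simp [regUpdate, h0, ← hxd, ← hyd, e2, saw]

lemma exists_next_step {d' R : ℕ} (e : Coord d S ≃ Fin d') (hN : 0 < N)
    (hR : 2 * N * d ^ (S + 1) ≤ R) (k : Fin S) (t : ℕ) :
    ∃ F, Realizes e R 1 F ∧ ∀ z z', Ready k z → AfterSteps N k t z z' →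
      AfterSteps N k (t + 1) z (F z') := by
  refine ⟨_, realizes_regUpdate e hR k
    (fun w => ![LinearMap.proj (Sum.inr (2, k, w)), LinearMap.proj (Sum.inr (3, k, w))])
    ![0, 0]
    ![![fun _ => 0, fun _ => 0],
      ![fun j => -(((N : ℝ) ^ (2 * t))⁻¹ * bumpCoeff N j),
        fun j => ((N : ℝ) ^ (2 * t))⁻¹ * bumpCoeff N j],
      ![fun j => sawCoeff N j + if (j : ℕ) = 0 then -1 else 0, fun _ => 0],
      ![fun _ => 0, fun j => sawCoeff N j + if (j : ℕ) = 0 then -1 else 0]]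
    ![0, 0, 0, 0], ?_⟩
  rintro z z' ⟨h0, hx, hy⟩ ⟨h1, h2, h3⟩
  refine ⟨h1, fun q k' w hk => by simp [regUpdate, hk, h2 q k' w hk], fun w => ?_⟩
  obtain ⟨r0, r1, r2, r3⟩ := h3 w
  have hx := hx (w k.succ)
  have hy := hy w
  rw [Function.iterate_succ_apply', Function.iterate_succ_apply']
  rw [approxMul] at r1 ⊢
  set x := z (Sum.inl (w k.succ)) with hxd
  set y := z (wordCoord w k.castSucc) with hyd
  have ha := saw_iterate_mem (x := (x + y) / 2) hN
    ⟨by linarith [hx.1, hy.1], by linarith [hx.2, hy.2]⟩ t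
  have hb := saw_iterate_mem (x := (x - y) / 2 + 1 / 2) hN
    ⟨by linarith [hx.1, hy.2], by linarith [hx.2, hy.1]⟩ t
  rw [bumpSum, bumpSum, Finset.sum_range_succ, Finset.sum_range_succ, ← bumpSum, ← bumpSum]
  set u := (saw N)^[t] ((x + y) / 2)
  set v := (saw N)^[t] ((x - y) / 2 + 1 / 2)
  have k1 := sum_coeff_sub_ite hN (sawCoeff N) (-1) ha.1
  have k2 := sum_coeff_sub_ite hN (sawCoeff N) (-1) hb.1
  refine ⟨by simp [regUpdate, r0], ?_, ?_, ?_⟩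
  · simp [regUpdate, r1, r2, r3, bump, mul_assoc, ← Finset.mul_sum]
    ring
  · simp [regUpdate, r2, k1, saw]
  · simp [regUpdate, r3, k2, saw]

lemma exists_steps {d' R : ℕ} (e : Coord d S ≃ Fin d') (hN : 0 < N)
    (hR : 2 * N * d ^ (S + 1) ≤ R) (k : Fin S) {t : ℕ} (ht : 1 ≤ t) :
    ∃ F, Realizes e R t F ∧ ∀ z, Ready k z → AfterSteps N k t z (F z) := by
  induction t, ht using Nat.le_induction with
  | base => exact exists_first_step e hN hR k
  | succ t _ ih =>
    obtain ⟨F, hF, hF'⟩ := ih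
    obtain ⟨G, hG, hG'⟩ := exists_next_step e hN hR k t
    exact ⟨G ∘ F, hG.comp hF, fun z hz => hG' z (F z) hz (hF' z hz)⟩

lemma exists_clip {d' R : ℕ} (e : Coord d S ≃ Fin d') (hN : 0 < N)
    (hR : 2 * N * d ^ (S + 1) ≤ R) (k : Fin S) :
    ∃ F, Realizes e R 1 F ∧ ∀ z, (∀ i, F z (Sum.inl i) = z (Sum.inl i)) ∧
      (∀ q k' w, k' ≠ k → F z (Sum.inr (q, k', w)) = z (Sum.inr (q, k', w))) ∧
      ∀ w, F z (Sum.inr (0, k, w)) = z (Sum.inr (0, k, w)) +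
        (relu (z (Sum.inr (1, k, w))) - relu (z (Sum.inr (1, k, w)) - 1)) := by
  refine ⟨_, realizes_regUpdate e hR k
    (fun w _ => LinearMap.proj (Sum.inr (1, k, w)))
    ![0, -1]
    ![![fun j => if (j : ℕ) = 0 then 1 else 0, fun j => if (j : ℕ) = 0 then -1 else 0],
      fun _ _ => 0, fun _ _ => 0, fun _ _ => 0]
    (fun _ => 0), fun z => ⟨fun i => rfl, fun q k' w hk => by simp [regUpdate, hk], fun w => ?_⟩⟩
  have key : ∀ r x : ℝ, ∑ j : Fin N, (if (j : ℕ) = 0 then r else 0) * relu (x - j / N) =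
      r * relu x := by
    intro r x
    rw [Finset.sum_eq_single ⟨0, hN⟩]
    · simp
    · intro j _ hj
      have : (j : ℕ) ≠ 0 := fun h => hj (Fin.ext h)
      simp [this]
    · simp
  simp [regUpdate, Fin.sum_univ_two, key, -ite_mul, ← sub_eq_add_neg]

/-- One full multiplication: the product register receives a clipped approximate product. -/
lemma exists_mul {d' R L : ℕ} (e : Coord d S ≃ Fin d') (hN : 0 < N) (hL : 0 < L)
    (hR : 2 * N * d ^ (S + 1) ≤ R) (k : Fin S) :
    ∃ F, Realizes e R (L + 1) F ∧ ∀ z, Ready k z →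
      (∀ i, F z (Sum.inl i) = z (Sum.inl i)) ∧
      (∀ q k' w, k' ≠ k → F z (Sum.inr (q, k', w)) = z (Sum.inr (q, k', w))) ∧
      ∀ w, F z (Sum.inr (0, k, w)) ∈ Set.Icc (0 : ℝ) 1 ∧
        |F z (Sum.inr (0, k, w)) - z (Sum.inl (w k.succ)) * z (wordCoord w k.castSucc)| ≤
          1 / (N : ℝ) ^ L := by
  obtain ⟨F, hF, hF'⟩ := exists_steps e hN hR k hL
  obtain ⟨G, hG, hG'⟩ := exists_clip e hN hR k
  refine ⟨G ∘ F, hG.comp hF, fun z hz => ?_⟩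
  obtain ⟨f1, f2, f3⟩ := hF' z hz
  obtain ⟨g1, g2, g3⟩ := hG' (F z)
  refine ⟨fun i => (g1 i).trans (f1 i), fun q k' w hk => (g2 q k' w hk).trans (f2 q k' w hk),
    fun w => ?_⟩
  obtain ⟨r0, r1, -, -⟩ := f3 w
  have hx := hz.2.1 (w k.succ)
  have hy := hz.2.2 w
  rw [Function.comp_apply, g3, r0, r1, zero_add]
  refine ⟨relu_sub_relu_mem _, (abs_relu_sub_relu_sub_le ?_).trans (abs_approxMul_sub_le hN L hx hy)⟩
  exact ⟨mul_nonneg hx.1 hy.1, mul_le_one₀ hx.2 hy.1 hy.2⟩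

/-- The product of the letters `w 0, …, w j`, evaluated at `x`. -/
def wordProd (x : Fin d → ℝ) (w : Fin (S + 1) → Fin d) (j : ℕ) : ℝ :=
  ∏ i with i.val ≤ j, x (w i)

lemma wordProd_succ (x : Fin d → ℝ) (w : Fin (S + 1) → Fin d) (k : Fin S) :
    wordProd x w (k + 1) = x (w k.succ) * wordProd x w k := by
  have : (Finset.univ.filter fun i : Fin (S + 1) => i.val ≤ k + 1) =
      insert k.succ (Finset.univ.filter fun i : Fin (S + 1) => i.val ≤ k) := by
    ext i
    simp [Fin.ext_iff]
    omega
  rw [wordProd, this, Finset.prod_insert (by simp), wordProd]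

lemma exists_words {d' R L : ℕ} (e : Coord d S ≃ Fin d') (hN : 0 < N) (hL : 0 < L)
    (hR : 2 * N * d ^ (S + 1) ≤ R) (k : ℕ) (hk : k ≤ S) :
    ∃ F, Realizes e R (k * (L + 1)) F ∧ ∀ x : Fin d → ℝ, (∀ i, x i ∈ Set.Icc (0 : ℝ) 1) →
      (∀ i, F (Sum.elim x 0) (Sum.inl i) = x i) ∧
      (∀ q (k' : Fin S) w, k ≤ k' → F (Sum.elim x 0) (Sum.inr (q, k', w)) = 0) ∧
      ∀ w (j : Fin (S + 1)), j.val ≤ k →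
        F (Sum.elim x 0) (wordCoord w j) ∈ Set.Icc (0 : ℝ) 1 ∧
        |F (Sum.elim x 0) (wordCoord w j) - wordProd x w j| ≤ j * (1 / (N : ℝ) ^ L) := by
  induction k with
  | zero =>
    refine ⟨id, by simpa using Realizes.zero, fun x hx => ⟨by simp, by simp, fun w j hj => ?_⟩⟩
    obtain rfl : j = 0 := Fin.ext (by simpa using hj)
    have : (Finset.univ.filter fun i : Fin (S + 1) => i.val ≤ 0) = {0} := by
      ext i
      simp only [Finset.mem_filter, Finset.mem_univ, true_and, Finset.mem_singleton, Fin.ext_iff,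
        Fin.val_zero, Nat.le_zero]
    have h0 : wordProd x w (0 : Fin (S + 1)) = x (w 0) := by
      rw [wordProd, Fin.val_zero, this, Finset.prod_singleton]
    rw [h0]
    exact ⟨hx (w 0), by simp [wordCoord]⟩
  | succ k ih =>
    obtain ⟨F, hF, hF'⟩ := ih (by omega)
    obtain ⟨G, hG, hG'⟩ := exists_mul e hN hL hR ⟨k, hk⟩
    refine ⟨G ∘ F, by simpa [add_mul] using hG.comp hF, fun x hx => ?_⟩
    obtain ⟨f1, f2, f3⟩ := hF' x hx
    simp only [Function.comp_apply]
    set z := F (Sum.elim x 0)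
    have hz : Ready ⟨k, hk⟩ z :=
      ⟨fun q w => f2 q _ w le_rfl, fun i => by rw [f1]; exact hx i, fun w => (f3 w _ le_rfl).1⟩
    obtain ⟨g1, g2, g3⟩ := hG' z hz
    refine ⟨fun i => (g1 i).trans (f1 i), fun q k' w hkk => ?_, fun w j hj => ?_⟩
    · rw [g2 q k' w (by rintro rfl; simp at hkk), f2 q k' w (by omega)]
    · rcases Nat.lt_or_ge k j.val with hlt | hle
      · obtain rfl : j = Fin.succ ⟨k, hk⟩ := Fin.ext (by simp; omega)
        obtain ⟨m1, m2⟩ := g3 w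
        obtain ⟨y1, y2⟩ := f3 w (Fin.castSucc ⟨k, hk⟩) le_rfl
        refine ⟨m1, ?_⟩
        rw [f1] at m2
        have hs := wordProd_succ x w ⟨k, hk⟩
        simp only [Fin.val_succ, Fin.val_castSucc] at y2 hs ⊢
        rw [hs]
        set y := z (wordCoord w (Fin.castSucc ⟨k, hk⟩))
        obtain ⟨x0, x1⟩ := hx (w (Fin.succ ⟨k, hk⟩))
        set x' := x (w (Fin.succ ⟨k, hk⟩))
        have h3 : |x' * y - x' * wordProd x w k| ≤ k * (1 / (N : ℝ) ^ L) := by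
          rw [← mul_sub, abs_mul, abs_of_nonneg x0]
          exact (mul_le_of_le_one_left (abs_nonneg _) x1).trans y2
        calc _ ≤ _ := abs_sub_le _ (x' * y) _
          _ ≤ 1 / (N : ℝ) ^ L + k * (1 / (N : ℝ) ^ L) := add_le_add m2 h3
          _ = _ := by push_cast; ring
      · have : G z (wordCoord w j) = z (wordCoord w j) := by
          induction j using Fin.cases with
          | zero => exact g1 _
          | succ j =>
            refine g2 _ _ _ fun h => ?_
            have := congrArg Fin.val h
            simp at hle this
            omega
        rw [this]
        exact f3 w j hle

end Words

/-! ### Monomials -/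

lemma exists_word_prod_eq {d : ℕ} (hd : 0 < d) (m : ℕ) (p : Fin d → ℕ) (hp : ∑ i, p i = m) :
    ∃ w : ℕ → Fin d, ∀ x : Fin d → ℝ,
      ∏ j ∈ Finset.range m, x (w j) = ∏ i, x i ^ p i := by
  induction m generalizing p with
  | zero =>
    have hp0 : ∀ i, p i = 0 := by simpa using hp
    exact ⟨fun _ => ⟨0, hd⟩, fun x => by simp [hp0]⟩
  | succ m ih =>
    obtain ⟨i, -, hi⟩ : ∃ i ∈ Finset.univ, p i ≠ 0 := by
      by_contra! h
      rw [Finset.sum_eq_zero h] at hp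
      omega
    have hpi : p = Function.update p i (p i - 1) + Pi.single i 1 := by
      ext j
      by_cases hj : j = i
      · subst hj; simp; omega
      · simp [hj]
    obtain ⟨w, hw⟩ := ih (Function.update p i (p i - 1)) (by
      rw [hpi] at hp
      simp only [Pi.add_apply, Finset.sum_add_distrib, Finset.sum_pi_single', Finset.mem_univ,
        if_true] at hp
      simpa using hp)
    refine ⟨Function.update w m i, fun x => ?_⟩
    rw [Finset.prod_range_succ, Function.update_self]
    have h1 : ∏ j ∈ Finset.range m, x (Function.update w m i j) =
        ∏ j ∈ Finset.range m, x (w j) := by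
      refine Finset.prod_congr rfl fun j hj => ?_
      rw [Function.update_of_ne (Finset.mem_range.1 hj).ne]
    rw [h1, hw]
    conv_rhs => rw [hpi]
    simp only [Pi.add_apply, pow_add, Finset.prod_mul_distrib]
    congr 1
    rw [Finset.prod_eq_single i (by intro j _ hj; simp [hj]) (by simp)]
    simp

lemma exists_wordProd_eq {d S : ℕ} (hd : 0 < d) (p : Fin d → ℕ) (h1 : 1 ≤ ∑ i, p i)
    (h2 : ∑ i, p i ≤ S + 1) :
    ∃ w : Fin (S + 1) → Fin d, ∀ x : Fin d → ℝ,
      wordProd x w (∑ i, p i - 1) = ∏ i, x i ^ p i := by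
  obtain ⟨w, hw⟩ := exists_word_prod_eq hd _ p rfl
  refine ⟨fun i => w i, fun x => ?_⟩
  rw [← hw, wordProd]
  refine Finset.prod_bij (fun i _ => i.val) (fun i hi => ?_) (fun i _ j _ h => Fin.ext h)
    (fun j hj => ?_) (fun _ _ => rfl)
  · simp at hi ⊢; omega
  · simp at hj
    exact ⟨⟨j, by omega⟩, by simp; omega, rfl⟩

lemma msym_rank_one {d n : ℕ} (hn : 0 < n) (p : Fin d → ℕ) (X : Matrix (Fin d) (Fin n) ℝ) :
    msym (fun _ : Fin 1 => p) X = ∑ j, ∏ i, X i j ^ p i := by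
  obtain ⟨n, rfl⟩ : ∃ m, n = m + 1 := ⟨n - 1, by omega⟩
  have h0 : ∀ h : 1 ≤ n + 1, Fin.castLE h (0 : Fin 1) = (0 : Fin (n + 1)) := fun _ => rfl
  simp only [msym, le_add_iff_nonneg_left, zero_le, dite_true, Fin.prod_univ_one, h0]
  rw [← Equiv.Perm.decomposeFin.symm.sum_comp, Fintype.sum_prod_type]
  simp only [Equiv.Perm.decomposeFin_symm_apply_zero, Finset.sum_const, Finset.card_univ,
    Fintype.card_perm, Fintype.card_fin, nsmul_eq_mul, ← Finset.mul_sum, add_tsub_cancel_right]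
  rw [inv_mul_cancel_left₀ (by positivity)]

/-! ### Summation by a single uniform attention head -/

/-- A block adding to each column the sum of all columns, and then the constant `c`. -/
noncomputable def sumBlock {d' : ℕ} (n : ℕ) (c : Fin d' → ℝ) : TransformerBlock d' where
  attn := ⟨d', 1, fun _ => (n : ℝ) • 1, fun _ => 1, fun _ => 0, fun _ => 0⟩
  ff := ⟨0, 0, 0, 0, c⟩

lemma sumBlock_apply {d' n : ℕ} (hn : 0 < n) (c : Fin d' → ℝ) (Y : Matrix (Fin d') (Fin n) ℝ)
    (i : Fin d') (j : Fin n) :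
    (sumBlock n c).apply Y i j = Y i j + ∑ l, Y i l + c i := by
  have hn' : (n : ℝ) ≠ 0 := by positivity
  let P : Matrix (Fin d') (Fin d') ℝ := 0
  let I : Matrix (Fin d') (Fin d') ℝ := 1
  have hff : ∀ Z : Matrix (Fin d') (Fin n) ℝ,
      FFLayer.apply ⟨0, 0, 0, 0, c⟩ Z = Z + Matrix.of fun i _ => c i := by
    intro Z
    simp [FFLayer.apply]
  change FFLayer.apply ⟨0, 0, 0, 0, c⟩
    (Y + ∑ _ : Fin 1, ((n : ℝ) • I) * (I * Y * softmax ((P * Y)ᵀ * (P * Y)))) i j = _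
  dsimp only [P, I]
  rw [hff, Fin.sum_univ_one, Matrix.zero_mul, Matrix.one_mul, Matrix.smul_mul,
    Matrix.one_mul]
  simp only [softmax, Matrix.add_apply, Matrix.smul_apply, Matrix.mul_apply, Matrix.of_apply]
  simp [← Finset.sum_mul]
  field_simp

/-- There is a Transformer network `TF₁` of width at most `12·s·d^s·N` and depth at
most `(s−1)(L+1)+1`, whose unique non-identity attention layer has a single head
(i.e. every attention layer acts as the identity or has one head), such that feeding
it `X ∈ [0,1]^{d×n}` embedded in the top-left block (zeros elsewhere), designated
coordinates of the `(n+1)`-st output column approximate every rank-1 monomial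
column-symmetric polynomial `m_p`, `1 ≤ |p| ≤ s`, with error at most
`n·(|p|−1)·N^{−L}`. -/
theorem stmt2 (d n s N L : ℕ) (hd : 0 < d) (hn : 0 < n) (hs : 0 < s)
    (hN : 0 < N) (hL : 0 < L) :
    ∃ (d' : ℕ) (net : List (TransformerBlock d')) (idx : (Fin d → ℕ) → Fin d'),
      d' ≤ 12 * s * d^s * N ∧
      (∀ B ∈ net, B.attn.m ≤ 12 * s * d^s * N ∧ B.ff.r ≤ 12 * s * d^s * N) ∧
      net.length ≤ (s-1)*(L+1) + 1 ∧
      (∀ B ∈ net,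
        (∀ (k : ℕ) (Y : Matrix (Fin d') (Fin k) ℝ), B.attn.apply Y = Y) ∨
        B.attn.h = 1) ∧
      ∀ p : Fin d → ℕ, 1 ≤ ∑ i, p i → (∑ i, p i) ≤ s →
        ∀ X : Matrix (Fin d) (Fin n) ℝ, (∀ i j, X i j ∈ Set.Icc (0:ℝ) 1) →
          |applyNet net (embed d' (n+1) X) (idx p) (Fin.last n) -
              msym (fun _ : Fin 1 => p) X| ≤
            (n : ℝ) * (((∑ i, p i : ℕ) : ℝ) - 1) / (N : ℝ)^L := by
  obtain ⟨S, rfl⟩ : ∃ S, s = S + 1 := ⟨s - 1, by omega⟩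
  let τ := Fin 4 × Fin S × (Fin (S + 1) → Fin d)
  let e : Coord d S ≃ Fin (d + Fintype.card τ) :=
    (Equiv.sumCongr (Equiv.refl _) (Fintype.equivFin τ)).trans finSumFinEquiv
  have hD : 1 ≤ d ^ (S + 1) := Nat.one_le_pow _ _ hd
  have hdD : d ≤ d ^ (S + 1) := Nat.le_self_pow (by omega) d
  have hτ : Fintype.card τ = 4 * (S * d ^ (S + 1)) := by simp [τ]
  have hwidth : d + Fintype.card τ ≤ 12 * (S + 1) * d ^ (S + 1) * N := by
    rw [hτ]
    calc d + 4 * (S * d ^ (S + 1)) ≤ 12 * (S + 1) * d ^ (S + 1) := by nlinarith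
      _ ≤ _ := Nat.le_mul_of_pos_right _ hN
  have hR : 2 * N * d ^ (S + 1) ≤ 12 * (S + 1) * d ^ (S + 1) * N := by
    calc 2 * N * d ^ (S + 1) = 2 * (d ^ (S + 1) * N) := by ring
      _ ≤ 12 * (S + 1) * (d ^ (S + 1) * N) := Nat.mul_le_mul_right _ (by omega)
      _ = _ := by ring
  obtain ⟨F, ⟨net, hlen, hnet, happ⟩, hF⟩ := exists_words e hN hL hR S le_rfl
  have : Nonempty (Fin d) := ⟨⟨0, hd⟩⟩
  choose! w hw using fun p : Fin d → ℕ => exists_wordProd_eq (S := S) hd p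
  have hw : ∀ p : Fin d → ℕ, 1 ≤ ∑ i, p i → ∑ i, p i ≤ S + 1 → ∀ x : Fin d → ℝ,
      wordProd x (w p) (∑ i, p i - 1) = ∏ i, x i ^ p i := fun p h1 h2 => hw p h1 h2
  refine ⟨d + Fintype.card τ,
    net ++ [sumBlock (n + 1) fun i => -(2 * F (Sum.elim 0 0) (e.symm i))],
    fun p => e (wordCoord (w p) (Fin.ofNat (S + 1) (∑ i, p i - 1))), hwidth, ?_, ?_, ?_, ?_⟩
  · intro B hB
    rcases List.mem_append.1 hB with h | h
    · exact (hnet B h).1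
    · obtain rfl := List.mem_singleton.1 h
      exact ⟨hwidth, Nat.zero_le _⟩
  · simp [hlen]
  · intro B hB
    rcases List.mem_append.1 hB with h | h
    · exact Or.inl (hnet B h).2
    · obtain rfl := List.mem_singleton.1 h
      exact Or.inr rfl
  intro p h1 h2 X hX
  have hcol : ∀ j : Fin n, (fun l => embed (d + Fintype.card τ) (n + 1) X (e l) j.castSucc) =
      Sum.elim (fun i => X i j) 0 := by
    intro j
    funext l
    rcases l with l | l <;> simp [embed, e]
  have hlast : (fun l => embed (d + Fintype.card τ) (n + 1) X (e l) (Fin.last n)) =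
      (Sum.elim 0 0 : Coord d S → ℝ) := by
    funext l
    rcases l with l | l <;> simp [embed]
  have hv : (Fin.ofNat (S + 1) (∑ i, p i - 1)).val = ∑ i, p i - 1 :=
    Nat.mod_eq_of_lt (by omega)
  have hcast : ((∑ i, p i - 1 : ℕ) : ℝ) = ((∑ i, p i : ℕ) : ℝ) - 1 := by
    rw [Nat.cast_sub h1, Nat.cast_one]
  have hout : applyNet (net ++ [sumBlock (n + 1) fun i => -(2 * F (Sum.elim 0 0) (e.symm i))])
      (embed (d + Fintype.card τ) (n + 1) X)
      (e (wordCoord (w p) (Fin.ofNat (S + 1) (∑ i, p i - 1)))) (Fin.last n) =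
      ∑ j, F (Sum.elim (fun i => X i j) 0)
        (wordCoord (w p) (Fin.ofNat (S + 1) (∑ i, p i - 1))) := by
    rw [applyNet_append, applyNet, List.foldl_cons, List.foldl_nil, sumBlock_apply n.succ_pos, Fin.sum_univ_castSucc]
    simp only [happ, hcol, hlast, Equiv.symm_apply_apply]
    ring
  rw [hout, msym_rank_one hn, ← Finset.sum_sub_distrib]
  refine (Finset.abs_sum_le_sum_abs _ _).trans ?_
  calc _ ≤ ∑ _j : Fin n, (((∑ i, p i : ℕ) : ℝ) - 1) * (1 / (N : ℝ) ^ L) := by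
        refine Finset.sum_le_sum fun j _ => ?_
        obtain ⟨-, -, h⟩ := hF (fun i => X i j) (fun i => hX i j)
        have := (h (w p) (Fin.ofNat (S + 1) (∑ i, p i - 1)) (by omega)).2
        rwa [hv, hw p h1 h2, hcast] at this
    _ = _ := by
        rw [Finset.sum_const, Finset.card_univ, Fintype.card_fin, nsmul_eq_mul]
        ring
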